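/- Define b_n = Σ_π Π_{p ∈ π} F_{|p|-1} where the sum is over noncrossing partitions π of {1,...,n}, the product over blocks p of π, and F_m is the m-th Fibonacci number (F_0 = 0, F_1 = 1, F_2 = 1). Then the generating function G(x) = Σ b_n xⁿ satisfies G(x) = (1 - xG(x))/(1 - xG(x) - x²G(x)²), and in particular (b_n) begins 1, 0, 1, 1, 4, 8, 25, 64. -/

import Mathlib

open scoped Classical

/-- A finpartition of `{0,…,n-1}` is noncrossing if there are no indices
`a < b < c < d` with `a, c` in one block and `b, d` in a different block. -/
def IsNoncrossing {n : ℕ} (π : Finpartition (Finset.univ : Finset (Fin n))) : Prop :=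
  ∀ a b c d : Fin n, a < b → b < c → c < d →
    ∀ B ∈ π.parts, ∀ B' ∈ π.parts, a ∈ B → c ∈ B → b ∈ B' → d ∈ B' → B = B'

/-- `b_n = Σ_π Π_{p ∈ π} F_{|p| - 1}`, summing over noncrossing partitions of
`{1,…,n}`, where `F` is the Fibonacci sequence (`F_0 = 0`, `F_1 = F_2 = 1`). -/
noncomputable def fibNCCount (n : ℕ) : ℂ :=
  ∑ π ∈ (Finset.univ : Finset (Finpartition (Finset.univ : Finset (Fin n)))).filter
      IsNoncrossing,
    ∏ B ∈ π.parts, (Nat.fib (B.card - 1) : ℂ)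

namespace NCPartition

section Order

variable {α β : Type*} [LinearOrder α] [LinearOrder β]

/-- `P` is the set of blocks of a noncrossing partition of `s`. Allowing equalities in the crossing
condition forces the disjointness of distinct blocks. -/
structure IsNC (s : Finset α) (P : Finset (Finset α)) : Prop where
  subset : ∀ B ∈ P, B ⊆ s
  empty_notMem : ∅ ∉ P
  exists_mem : ∀ x ∈ s, ∃ B ∈ P, x ∈ B
  eq_of_cross : ∀ B ∈ P, ∀ C ∈ P, ∀ w x y z, w ≤ x → x ≤ y → y ≤ z →
    w ∈ B → x ∈ C → y ∈ B → z ∈ C → B = C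

theorem IsNC.eq_of_mem {s : Finset α} {P : Finset (Finset α)} (h : IsNC s P) {B C : Finset α}
    {x : α} (hB : B ∈ P) (hC : C ∈ P) (hxB : x ∈ B) (hxC : x ∈ C) : B = C :=
  h.eq_of_cross B hB C hC x x x x le_rfl le_rfl le_rfl hxB hxC hxB hxC

/-- The finset of noncrossing partitions of `s`. -/
noncomputable def nc (s : Finset α) : Finset (Finset (Finset α)) :=
  s.powerset.powerset.filter (IsNC s)

@[simp]
theorem mem_nc {s : Finset α} {P : Finset (Finset α)} : P ∈ nc s ↔ IsNC s P := by
  simp only [nc, Finset.mem_filter, Finset.mem_powerset, and_iff_right_iff_imp]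
  exact fun h B hB => Finset.mem_powerset.2 (h.subset B hB)

theorem isNC_map_iff (e : α ↪o β) {s : Finset α} {P : Finset (Finset α)} :
    IsNC (s.map e.toEmbedding) (P.map (Finset.mapEmbedding e.toEmbedding).toEmbedding) ↔
      IsNC s P := by
  constructor
  · rintro ⟨h1, h2, h3, h4⟩
    refine ⟨fun B hB => ?_, fun h => h2 ?_, fun x hx => ?_, fun B hB C hC w x y z hwx hxy hyz
      hw hx hy hz => ?_⟩
    · exact Finset.map_subset_map.1 (h1 _ (Finset.mem_map_of_mem _ hB))
    · exact Finset.mem_map.2 ⟨∅, h, by simp⟩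
    · obtain ⟨B, hB, hxB⟩ := h3 (e x) (Finset.mem_map_of_mem _ hx)
      obtain ⟨C, hC, rfl⟩ := Finset.mem_map.1 hB
      exact ⟨C, hC, by simpa using hxB⟩
    · have := h4 _ (Finset.mem_map_of_mem _ hB) _ (Finset.mem_map_of_mem _ hC)
        (e w) (e x) (e y) (e z) (by simpa) (by simpa) (by simpa) (by simpa) (by simpa) (by simpa)
        (by simpa)
      exact (Finset.mapEmbedding e.toEmbedding).injective this
  · rintro ⟨h1, h2, h3, h4⟩
    refine ⟨fun B hB => ?_, fun h => h2 ?_, fun x hx => ?_, fun B hB C hC w x y z hwx hxy hyz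
      hw hx hy hz => ?_⟩
    · obtain ⟨B', hB', rfl⟩ := Finset.mem_map.1 hB
      exact Finset.map_subset_map.2 (h1 _ hB')
    · obtain ⟨B, hB, hB0⟩ := Finset.mem_map.1 h
      have : B = ∅ := by simpa using hB0
      exact this ▸ hB
    · obtain ⟨x', hx', rfl⟩ := Finset.mem_map.1 hx
      obtain ⟨B, hB, hxB⟩ := h3 x' hx'
      exact ⟨_, Finset.mem_map_of_mem _ hB, by simpa using hxB⟩
    · obtain ⟨B', hB', rfl⟩ := Finset.mem_map.1 hB
      obtain ⟨C', hC', rfl⟩ := Finset.mem_map.1 hC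
      obtain ⟨w', hw', rfl⟩ := Finset.mem_map.1 hw
      obtain ⟨x', hx', rfl⟩ := Finset.mem_map.1 hx
      obtain ⟨y', hy', rfl⟩ := Finset.mem_map.1 hy
      obtain ⟨z', hz', rfl⟩ := Finset.mem_map.1 hz
      rw [h4 B' hB' C' hC' w' x' y' z' (by simpa using hwx) (by simpa using hxy)
        (by simpa using hyz) hw' hx' hy' hz']

theorem nc_map (e : α ↪o β) (s : Finset α) :
    nc (s.map e.toEmbedding) = (nc s).map
      (Finset.mapEmbedding (Finset.mapEmbedding e.toEmbedding).toEmbedding).toEmbedding := by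
  ext Q
  simp only [mem_nc, Finset.mem_map, RelEmbedding.coe_toEmbedding, Finset.mapEmbedding_apply]
  constructor
  · intro h
    have : Q ⊆ s.powerset.map (Finset.mapEmbedding e.toEmbedding).toEmbedding := by
      intro B hB
      obtain ⟨u, hu, rfl⟩ := Finset.subset_map_iff.1 (h.subset B hB)
      exact Finset.mem_map.2 ⟨u, by simpa using hu, rfl⟩
    obtain ⟨P, -, rfl⟩ := Finset.subset_map_iff.1 this
    exact ⟨P, (isNC_map_iff e).1 h, rfl⟩
  · rintro ⟨P, hP, rfl⟩
    exact (isNC_map_iff e).2 hP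

/-- The sum over noncrossing partitions of `s` of the product of the weights `f |B|` of the
blocks `B`. -/
noncomputable def total (f : ℕ → ℂ) (s : Finset α) : ℂ :=
  ∑ P ∈ nc s, ∏ B ∈ P, f B.card

theorem total_map (f : ℕ → ℂ) (e : α ↪o β) (s : Finset α) :
    total f (s.map e.toEmbedding) = total f s := by
  simp [total, nc_map, Finset.mapEmbedding_apply]

/-- The block of `P` containing `x`, or `∅` if there is none. -/
def block (P : Finset (Finset α)) (x : α) : Finset α :=
  (P.filter (x ∈ ·)).sup id

theorem IsNC.block_eq {s : Finset α} {P : Finset (Finset α)} (h : IsNC s P) {B : Finset α} {x : α}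
    (hB : B ∈ P) (hx : x ∈ B) : block P x = B := by
  have : P.filter (x ∈ ·) = {B} := by
    ext C
    simp only [Finset.mem_filter, Finset.mem_singleton]
    exact ⟨fun hC => h.eq_of_mem hC.1 hB hC.2 hx, by rintro rfl; exact ⟨hB, hx⟩⟩
  simp [block, this]

theorem IsNC.block_mem {s : Finset α} {P : Finset (Finset α)} (h : IsNC s P) {x : α}
    (hx : x ∈ s) : block P x ∈ P ∧ x ∈ block P x := by
  obtain ⟨B, hB, hxB⟩ := h.exists_mem x hx
  rw [h.block_eq hB hxB]
  exact ⟨hB, hxB⟩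

theorem IsNC.block_eq_empty {s : Finset α} {P : Finset (Finset α)} (h : IsNC s P) {x : α}
    (hx : x ∉ s) : block P x = ∅ := by
  have : P.filter (x ∈ ·) = ∅ := by
    ext C
    simp only [Finset.mem_filter, Finset.notMem_empty, iff_false, not_and]
    exact fun hC hxC => hx (h.subset C hC hxC)
  simp [block, this]

theorem IsNC.block_subset {s : Finset α} {P : Finset (Finset α)} (h : IsNC s P) (x : α) :
    block P x ⊆ s := by
  by_cases hx : x ∈ s
  · exact h.subset _ (h.block_mem hx).1
  · simp [h.block_eq_empty hx]

end Order

/-- Glue a partition of `Ico (a + 1) m` and a partition of `Ico m b`, adding `a` to the block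
of `m`. -/
def join (a m : ℕ) (P Q : Finset (Finset ℕ)) : Finset (Finset ℕ) :=
  insert (insert a (block Q m)) (P ∪ Q.erase (block Q m))

theorem mem_join {a m : ℕ} {P Q : Finset (Finset ℕ)} {C : Finset ℕ} :
    C ∈ join a m P Q ↔ C = insert a (block Q m) ∨ C ∈ P ∨ (C ≠ block Q m ∧ C ∈ Q) := by
  simp [join]

/-- The second smallest element of the block of `a`, or `b` if that block is `{a}`. -/
def second (a b : ℕ) (R : Finset (Finset ℕ)) : ℕ :=
  (insert b ((block R a).erase a)).min' (Finset.insert_nonempty _ _)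

/-- The blocks lying between `a` and the next element of its block. -/
def left (a b : ℕ) (R : Finset (Finset ℕ)) : Finset (Finset ℕ) :=
  R.filter (· ⊆ Finset.Ico (a + 1) (second a b R))

/-- The partition induced on the elements from the second element of the block of `a` on. -/
def right (a b : ℕ) (R : Finset (Finset ℕ)) : Finset (Finset ℕ) :=
  (insert ((block R a).erase a) (R.filter (· ⊆ Finset.Ico (second a b R) b))).erase ∅

theorem mem_left {a b : ℕ} {R : Finset (Finset ℕ)} {C : Finset ℕ} :
    C ∈ left a b R ↔ C ∈ R ∧ C ⊆ Finset.Ico (a + 1) (second a b R) := by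
  simp [left]

theorem mem_right {a b : ℕ} {R : Finset (Finset ℕ)} {C : Finset ℕ} :
    C ∈ right a b R ↔ C ≠ ∅ ∧
      (C = (block R a).erase a ∨ (C ∈ R ∧ C ⊆ Finset.Ico (second a b R) b)) := by
  simp [right]

section Join

variable {a m b : ℕ} {P Q : Finset (Finset ℕ)}

theorem isNC_join (ham : a < m) (hmb : m ≤ b)
    (hP : IsNC (Finset.Ico (a + 1) m) P) (hQ : IsNC (Finset.Ico m b) Q) :
    IsNC (Finset.Ico a b) (join a m P Q) := by
  have hP' : ∀ B ∈ P, ∀ x ∈ B, a < x ∧ x < m := fun B hB x hx => by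
    have := hP.subset B hB hx
    rw [Finset.mem_Ico] at this
    omega
  have hQ' : ∀ B ∈ Q, ∀ x ∈ B, m ≤ x ∧ x < b := fun B hB x hx =>
    Finset.mem_Ico.1 (hQ.subset B hB hx)
  have hM : ∀ x ∈ block Q m, m ≤ x ∧ x < b := fun x hx =>
    Finset.mem_Ico.1 (hQ.block_subset m hx)
  have hM' : ∀ x ∈ block Q m, block Q m ∈ Q ∧ m ∈ block Q m := fun x hx =>
    hQ.block_mem (Finset.mem_Ico.2 (by have := hM x hx; omega))
  refine ⟨fun B hB x hx => ?_, fun h => ?_, fun x hx => ?_, fun B hB C hC w x y z hwx hxy hyz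
      hw hx hy hz => ?_⟩
  · rw [Finset.mem_Ico]
    rcases mem_join.1 hB with rfl | hB | ⟨-, hB⟩
    · rcases Finset.mem_insert.1 hx with rfl | hx
      · omega
      · have := hM x hx
        omega
    · have := hP' B hB x hx
      omega
    · have := hQ' B hB x hx
      omega
  · rcases mem_join.1 h with h | h | ⟨-, h⟩
    · exact Finset.insert_ne_empty _ _ h.symm
    · exact hP.empty_notMem h
    · exact hQ.empty_notMem h
  · rw [Finset.mem_Ico] at hx
    rcases eq_or_ne x a with rfl | hxa
    · exact ⟨_, mem_join.2 (Or.inl rfl), Finset.mem_insert_self _ _⟩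
    rcases lt_or_ge x m with hxm | hxm
    · obtain ⟨B, hB, hxB⟩ := hP.exists_mem x (Finset.mem_Ico.2 (by omega))
      exact ⟨B, mem_join.2 (Or.inr (Or.inl hB)), hxB⟩
    · obtain ⟨B, hB, hxB⟩ := hQ.exists_mem x (Finset.mem_Ico.2 (by omega))
      by_cases hBM : B = block Q m
      · exact ⟨_, mem_join.2 (Or.inl rfl), Finset.mem_insert_of_mem (hBM ▸ hxB)⟩
      · exact ⟨B, mem_join.2 (Or.inr (Or.inr ⟨hBM, hB⟩)), hxB⟩
  · rcases mem_join.1 hB with rfl | hB | ⟨hBM, hB⟩ <;>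
      rcases mem_join.1 hC with rfl | hC | ⟨hCM, hC⟩
    · rfl
    · have h1 := hP' C hC x hx
      have h2 := hP' C hC z hz
      rcases Finset.mem_insert.1 hy with rfl | hy
      · omega
      · have := hM y hy
        omega
    · have h1 := hQ' C hC x hx
      rcases Finset.mem_insert.1 hy with rfl | hy
      · omega
      · exact absurd (hQ.eq_of_cross _ (hM' y hy).1 C hC m x y z h1.1 hxy hyz (hM' y hy).2
          hx hy hz).symm hCM
    · have h1 := hP' B hB w hw
      have h2 := hP' B hB y hy
      rcases Finset.mem_insert.1 hx with rfl | hx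
      · omega
      · have := hM x hx
        omega
    · exact hP.eq_of_cross B hB C hC w x y z hwx hxy hyz hw hx hy hz
    · have h1 := hP' B hB y hy
      have h2 := hQ' C hC x hx
      omega
    · have h1 := hQ' B hB w hw
      rcases Finset.mem_insert.1 hx with rfl | hx
      · omega
      rcases Finset.mem_insert.1 hz with rfl | hz
      · omega
      exact absurd (hQ.eq_of_cross B hB _ (hM' x hx).1 w x y z hwx hxy hyz hw hx hy hz) hBM
    · have h1 := hQ' B hB w hw
      have h2 := hP' C hC x hx
      omega
    · exact hQ.eq_of_cross B hB C hC w x y z hwx hxy hyz hw hx hy hz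

theorem block_join (ham : a < m) (hmb : m ≤ b)
    (hP : IsNC (Finset.Ico (a + 1) m) P) (hQ : IsNC (Finset.Ico m b) Q) :
    block (join a m P Q) a = insert a (block Q m) :=
  (isNC_join ham hmb hP hQ).block_eq (Finset.mem_insert_self _ _) (Finset.mem_insert_self _ _)

theorem notMem_block_of_lt (ham : a < m) (hQ : IsNC (Finset.Ico m b) Q) : a ∉ block Q m :=
  fun h => by
    have := Finset.mem_Ico.1 (hQ.block_subset m h)
    omega

theorem second_join (ham : a < m) (hmb : m ≤ b)
    (hP : IsNC (Finset.Ico (a + 1) m) P) (hQ : IsNC (Finset.Ico m b) Q) :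
    second a b (join a m P Q) = m := by
  simp only [second, block_join ham hmb hP hQ,
    Finset.erase_insert (notMem_block_of_lt ham hQ)]
  refine le_antisymm (Finset.min'_le _ _ ?_) (Finset.le_min' _ _ _ fun x hx => ?_)
  · rcases hmb.eq_or_lt with rfl | hlt
    · exact Finset.mem_insert_self _ _
    · exact Finset.mem_insert_of_mem (hQ.block_mem (Finset.mem_Ico.2 ⟨le_rfl, hlt⟩)).2
  · rcases Finset.mem_insert.1 hx with rfl | hx
    · exact hmb
    · exact (Finset.mem_Ico.1 (hQ.block_subset m hx)).1

theorem left_join (ham : a < m) (hmb : m ≤ b)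
    (hP : IsNC (Finset.Ico (a + 1) m) P) (hQ : IsNC (Finset.Ico m b) Q) :
    left a b (join a m P Q) = P := by
  ext C
  rw [mem_left, second_join ham hmb hP hQ, mem_join]
  constructor
  · rintro ⟨rfl | hC | ⟨-, hC⟩, hs⟩
    · have := Finset.mem_Ico.1 (hs (Finset.mem_insert_self _ _))
      omega
    · exact hC
    · obtain ⟨x, hx⟩ := Finset.nonempty_iff_ne_empty.2 fun h => hQ.empty_notMem (h ▸ hC)
      have h1 := Finset.mem_Ico.1 (hs hx)
      have h2 := Finset.mem_Ico.1 (hQ.subset C hC hx)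
      omega
  · exact fun hC => ⟨Or.inr (Or.inl hC), hP.subset C hC⟩

theorem right_join (ham : a < m) (hmb : m ≤ b)
    (hP : IsNC (Finset.Ico (a + 1) m) P) (hQ : IsNC (Finset.Ico m b) Q) :
    right a b (join a m P Q) = Q := by
  ext C
  rw [mem_right, second_join ham hmb hP hQ, mem_join, block_join ham hmb hP hQ,
    Finset.erase_insert (notMem_block_of_lt ham hQ)]
  constructor
  · rintro ⟨h0, rfl | ⟨rfl | hC | ⟨-, hC⟩, hs⟩⟩
    · by_cases hm : m ∈ Finset.Ico m b
      · exact (hQ.block_mem hm).1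
      · exact absurd (hQ.block_eq_empty hm) h0
    · have := Finset.mem_Ico.1 (hs (Finset.mem_insert_self _ _))
      omega
    · obtain ⟨x, hx⟩ := Finset.nonempty_iff_ne_empty.2 h0
      have h1 := Finset.mem_Ico.1 (hs hx)
      have h2 := Finset.mem_Ico.1 (hP.subset C hC hx)
      omega
    · exact hC
  · intro hC
    refine ⟨fun h => hQ.empty_notMem (h ▸ hC), ?_⟩
    by_cases hCM : C = block Q m
    · exact Or.inl hCM
    · exact Or.inr ⟨Or.inr (Or.inr ⟨hCM, hC⟩), hQ.subset C hC⟩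

theorem prod_join (f : ℕ → ℂ) (j : ℕ) (ham : a < m) (hmb : m ≤ b)
    (hP : IsNC (Finset.Ico (a + 1) m) P) (hQ : IsNC (Finset.Ico m b) Q) :
    f ((block (join a m P Q) a).card + j) *
        ∏ B ∈ (join a m P Q).erase (block (join a m P Q) a), f B.card =
      (∏ B ∈ P, f B.card) *
        (f ((block Q m).card + (j + 1)) * ∏ B ∈ Q.erase (block Q m), f B.card) := by
  have hdisj : Disjoint P (Q.erase (block Q m)) := by
    refine Finset.disjoint_left.2 fun C hCP hCQ => ?_
    have hCQ := Finset.mem_of_mem_erase hCQ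
    obtain ⟨x, hx⟩ := Finset.nonempty_iff_ne_empty.2 fun h => hP.empty_notMem (h ▸ hCP)
    have h1 := Finset.mem_Ico.1 (hP.subset C hCP hx)
    have h2 := Finset.mem_Ico.1 (hQ.subset C hCQ hx)
    omega
  have hnot : insert a (block Q m) ∉ P ∪ Q.erase (block Q m) := by
    intro h
    rcases Finset.mem_union.1 h with h | h
    · have := Finset.mem_Ico.1 (hP.subset _ h (Finset.mem_insert_self _ _))
      omega
    · have := Finset.mem_Ico.1
        (hQ.subset _ (Finset.mem_of_mem_erase h) (Finset.mem_insert_self _ _))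
      omega
  rw [block_join ham hmb hP hQ, join, Finset.erase_insert hnot, Finset.prod_union hdisj,
    Finset.card_insert_of_notMem (notMem_block_of_lt ham hQ), add_assoc, add_comm 1 j]
  ring

end Join

section Split

variable {a b : ℕ} {R : Finset (Finset ℕ)}

theorem second_le : second a b R ≤ b :=
  Finset.min'_le _ _ (Finset.mem_insert_self _ _)

theorem second_le_of_mem {x : ℕ} (hx : x ∈ block R a) (hxa : x ≠ a) : second a b R ≤ x :=
  Finset.min'_le _ _ (Finset.mem_insert_of_mem (Finset.mem_erase.2 ⟨hxa, hx⟩))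

theorem second_eq_or_mem : second a b R = b ∨ second a b R ∈ (block R a).erase a :=
  Finset.mem_insert.1 (Finset.min'_mem _ _)

theorem lt_second (hab : a < b) (hR : IsNC (Finset.Ico a b) R) : a < second a b R := by
  rcases second_eq_or_mem (a := a) (b := b) (R := R) with h | h
  · omega
  · have h1 := Finset.mem_erase.1 h
    have h2 := Finset.mem_Ico.1 (hR.block_subset a h1.2)
    omega

theorem subset_or_subset (hab : a < b) (hR : IsNC (Finset.Ico a b) R) {C : Finset ℕ}
    (hC : C ∈ R) (hne : C ≠ block R a) :
    C ⊆ Finset.Ico (a + 1) (second a b R) ∨ C ⊆ Finset.Ico (second a b R) b := by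
  obtain ⟨hA, haA⟩ := hR.block_mem (Finset.mem_Ico.2 ⟨le_rfl, hab⟩)
  have haC : a ∉ C := fun h => hne (hR.eq_of_mem hC hA h haA)
  by_contra! h
  obtain ⟨y, hy, hy'⟩ := Finset.not_subset.1 h.1
  obtain ⟨x, hx, hx'⟩ := Finset.not_subset.1 h.2
  have hxa : x ≠ a := by rintro rfl; exact haC hx
  have hya : y ≠ a := by rintro rfl; exact haC hy
  have h1 := Finset.mem_Ico.1 (hR.subset C hC hx)
  have h2 := Finset.mem_Ico.1 (hR.subset C hC hy)
  rw [Finset.mem_Ico] at hx' hy'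
  rcases second_eq_or_mem (a := a) (b := b) (R := R) with h | h
  · omega
  · exact hne (hR.eq_of_cross _ hA C hC a x (second a b R) y (by omega) (by omega) (by omega)
      haA hx (Finset.mem_of_mem_erase h) hy).symm

theorem isNC_left (hab : a < b) (hR : IsNC (Finset.Ico a b) R) :
    IsNC (Finset.Ico (a + 1) (second a b R)) (left a b R) := by
  refine ⟨fun B hB => (mem_left.1 hB).2, fun h => hR.empty_notMem (mem_left.1 h).1,
    fun x hx => ?_, fun B hB C hC =>
      hR.eq_of_cross B (mem_left.1 hB).1 C (mem_left.1 hC).1⟩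
  have hx' := Finset.mem_Ico.1 hx
  have hsb := second_le (a := a) (b := b) (R := R)
  obtain ⟨C, hC, hxC⟩ := hR.exists_mem x (Finset.mem_Ico.2 (by omega))
  refine ⟨C, mem_left.2 ⟨hC, (subset_or_subset hab hR hC ?_).resolve_right fun h => ?_⟩, hxC⟩
  · rintro rfl
    have := second_le_of_mem (b := b) hxC (by omega)
    omega
  · have := Finset.mem_Ico.1 (h hxC)
    omega

theorem isNC_right (hab : a < b) (hR : IsNC (Finset.Ico a b) R) :
    IsNC (Finset.Ico (second a b R) b) (right a b R) := by
  obtain ⟨hA, haA⟩ := hR.block_mem (Finset.mem_Ico.2 ⟨le_rfl, hab⟩)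
  have has := lt_second hab hR
  have hout : ∀ C, C ⊆ Finset.Ico (second a b R) b → block R a ≠ C := by
    rintro C hC rfl
    have := Finset.mem_Ico.1 (hC haA)
    omega
  refine ⟨fun B hB x hx => ?_, fun h => (mem_right.1 h).1 rfl, fun x hx => ?_,
    fun B hB C hC w x y z hwx hxy hyz hw hx hy hz => ?_⟩
  · rcases (mem_right.1 hB).2 with rfl | ⟨-, h⟩
    · have h1 := Finset.mem_erase.1 hx
      exact Finset.mem_Ico.2
        ⟨second_le_of_mem h1.2 h1.1, (Finset.mem_Ico.1 (hR.block_subset a h1.2)).2⟩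
    · exact h hx
  · have hx' := Finset.mem_Ico.1 hx
    obtain ⟨C, hC, hxC⟩ := hR.exists_mem x (Finset.mem_Ico.2 (by omega))
    by_cases hCA : C = block R a
    · have hxA : x ∈ (block R a).erase a := Finset.mem_erase.2 ⟨by omega, hCA ▸ hxC⟩
      exact ⟨_, mem_right.2 ⟨Finset.ne_empty_of_mem hxA, Or.inl rfl⟩, hxA⟩
    · refine ⟨C, mem_right.2 ⟨Finset.ne_empty_of_mem hxC, Or.inr ⟨hC,
        (subset_or_subset hab hR hC hCA).resolve_left fun h => ?_⟩⟩, hxC⟩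
      have := Finset.mem_Ico.1 (h hxC)
      omega
  · rcases (mem_right.1 hB).2 with rfl | ⟨hB, hBs⟩ <;>
      rcases (mem_right.1 hC).2 with rfl | ⟨hC, hCs⟩
    · rfl
    · exact absurd (hR.eq_of_cross _ hA C hC w x y z hwx hxy hyz (Finset.mem_of_mem_erase hw) hx
        (Finset.mem_of_mem_erase hy) hz) (hout C hCs)
    · exact absurd (hR.eq_of_cross B hB _ hA w x y z hwx hxy hyz hw (Finset.mem_of_mem_erase hx)
        hy (Finset.mem_of_mem_erase hz)).symm (hout B hBs)
    · exact hR.eq_of_cross B hB C hC w x y z hwx hxy hyz hw hx hy hz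

theorem block_right (hab : a < b) (hR : IsNC (Finset.Ico a b) R) :
    block (right a b R) (second a b R) = (block R a).erase a := by
  rcases second_eq_or_mem (a := a) (b := b) (R := R) with h | h
  · rw [(isNC_right hab hR).block_eq_empty (by simp [h])]
    refine (Finset.eq_empty_of_forall_notMem fun x hx => ?_).symm
    have h1 := Finset.mem_erase.1 hx
    have h2 := second_le_of_mem (b := b) h1.2 h1.1
    have h3 := Finset.mem_Ico.1 (hR.block_subset a h1.2)
    omega
  · exact (isNC_right hab hR).block_eq
      (mem_right.2 ⟨Finset.ne_empty_of_mem h, Or.inl rfl⟩) h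

theorem join_left_right (hab : a < b) (hR : IsNC (Finset.Ico a b) R) :
    join a (second a b R) (left a b R) (right a b R) = R := by
  obtain ⟨hA, haA⟩ := hR.block_mem (Finset.mem_Ico.2 ⟨le_rfl, hab⟩)
  ext C
  rw [mem_join, block_right hab hR, Finset.insert_erase haA, mem_left, mem_right]
  constructor
  · rintro (rfl | ⟨hC, -⟩ | ⟨hne, -, h | ⟨hC, -⟩⟩)
    · exact hA
    · exact hC
    · exact absurd h hne
    · exact hC
  · intro hC
    by_cases hCA : C = block R a
    · exact Or.inl hCA
    rcases subset_or_subset hab hR hC hCA with h | h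
    · exact Or.inr (Or.inl ⟨hC, h⟩)
    · obtain ⟨x, hx⟩ := Finset.nonempty_iff_ne_empty.2 fun h => hR.empty_notMem (h ▸ hC)
      refine Or.inr (Or.inr ⟨fun h' => hCA ?_, Finset.ne_empty_of_mem hx, Or.inr ⟨hC, h⟩⟩)
      exact hR.eq_of_mem hC hA hx (Finset.mem_of_mem_erase (h' ▸ hx))

end Split

/-- The sum over noncrossing partitions of `Ico a b`, where the block of `a` is
counted as if it had `j` additional elements. -/
noncomputable def shifted (f : ℕ → ℂ) (j a b : ℕ) : ℂ :=
  ∑ P ∈ nc (Finset.Ico a b), f ((block P a).card + j) * ∏ B ∈ P.erase (block P a), f B.card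

theorem nc_empty {α : Type*} [LinearOrder α] : nc (∅ : Finset α) = {∅} := by
  ext P
  simp only [mem_nc, Finset.mem_singleton]
  constructor
  · intro h
    refine Finset.eq_empty_of_forall_notMem fun B hB => ?_
    exact h.empty_notMem (Finset.subset_empty.1 (h.subset B hB) ▸ hB)
  · rintro rfl
    constructor <;> simp

theorem shifted_self (f : ℕ → ℂ) (j a : ℕ) : shifted f j a a = f j := by
  simp [shifted, nc_empty, block]

theorem shifted_zero {f : ℕ → ℂ} (hf : f 0 = 1) (a b : ℕ) :
    shifted f 0 a b = total f (Finset.Ico a b) := by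
  refine Finset.sum_congr rfl fun P hP => ?_
  rw [mem_nc] at hP
  by_cases ha : a ∈ Finset.Ico a b
  · exact Finset.mul_prod_erase P (fun B => f B.card) (hP.block_mem ha).1
  · rw [hP.block_eq_empty ha, Finset.erase_eq_of_notMem hP.empty_notMem]
    simp [hf]

theorem shifted_eq_sum (f : ℕ → ℂ) (j : ℕ) {a b : ℕ} (hab : a < b) :
    shifted f j a b = ∑ m ∈ Finset.Ioc a b,
      total f (Finset.Ico (a + 1) m) * shifted f (j + 1) m b := by
  simp only [shifted, total, Finset.sum_mul_sum, ← Finset.sum_product', Finset.sum_sigma']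
  symm
  refine Finset.sum_bij'
    (t := nc (Finset.Ico a b))
    (fun p _ => join a p.1 p.2.1 p.2.2)
    (fun R _ => ⟨second a b R, left a b R, right a b R⟩) ?_ ?_ ?_ ?_ ?_
  · rintro ⟨m, P, Q⟩ h
    simp only [Finset.mem_sigma, Finset.mem_Ioc, Finset.mem_product, mem_nc] at h
    exact mem_nc.2 (isNC_join h.1.1 h.1.2 h.2.1 h.2.2)
  · intro R hR
    rw [mem_nc] at hR
    simp only [Finset.mem_sigma, Finset.mem_Ioc, Finset.mem_product, mem_nc]
    exact ⟨⟨lt_second hab hR, second_le⟩, isNC_left hab hR, isNC_right hab hR⟩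
  · rintro ⟨m, P, Q⟩ h
    simp only [Finset.mem_sigma, Finset.mem_Ioc, Finset.mem_product, mem_nc] at h
    simp only [second_join h.1.1 h.1.2 h.2.1 h.2.2, left_join h.1.1 h.1.2 h.2.1 h.2.2,
      right_join h.1.1 h.1.2 h.2.1 h.2.2]
  · intro R hR
    exact join_left_right hab (mem_nc.1 hR)
  · rintro ⟨m, P, Q⟩ h
    simp only [Finset.mem_sigma, Finset.mem_Ioc, Finset.mem_product, mem_nc] at h
    exact (prod_join f j h.1.1 h.1.2 h.2.1 h.2.2).symm

theorem total_Ico_add (f : ℕ → ℂ) (a n : ℕ) :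
    total f (Finset.Ico a (a + n)) = total f (Finset.range n) := by
  rw [← total_map f (OrderEmbedding.addLeft a) (Finset.range n)]
  congr 1
  ext x
  simp only [Finset.mem_Ico, Finset.mem_map, Finset.mem_range, RelEmbedding.coe_toEmbedding,
    OrderEmbedding.addLeft_apply]
  constructor
  · exact fun h => ⟨x - a, by omega, by omega⟩
  · rintro ⟨y, hy, rfl⟩
    omega

theorem shifted_add_succ (f : ℕ → ℂ) (j a n : ℕ) :
    shifted f j a (a + (n + 1)) = ∑ p ∈ Finset.HasAntidiagonal.antidiagonal n,
      total f (Finset.range p.1) * shifted f (j + 1) (a + 1 + p.1) (a + 1 + p.1 + p.2) := by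
  rw [shifted_eq_sum f j (by omega)]
  symm
  refine Finset.sum_bij' (fun p _ => a + 1 + p.1) (fun m _ => (m - (a + 1), a + 1 + n - m))
    ?_ ?_ ?_ ?_ ?_
  · rintro ⟨i, k⟩ h
    simp only [Finset.HasAntidiagonal.mem_antidiagonal] at h
    simp only [Finset.mem_Ioc]
    omega
  · intro m h
    simp only [Finset.mem_Ioc] at h
    simp only [Finset.HasAntidiagonal.mem_antidiagonal]
    omega
  · rintro ⟨i, k⟩ h
    simp only [Finset.HasAntidiagonal.mem_antidiagonal] at h
    simp only [Prod.mk.injEq]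
    omega
  · intro m h
    simp only [Finset.mem_Ioc] at h
    simp only
    omega
  · rintro ⟨i, k⟩ h
    simp only [Finset.HasAntidiagonal.mem_antidiagonal] at h
    simp only [total_Ico_add, show a + 1 + i + k = a + (n + 1) by omega]

theorem shifted_add (f : ℕ → ℂ) (j a n : ℕ) : shifted f j a (a + n) = shifted f j 0 n := by
  induction n using Nat.strong_induction_on generalizing j a with
  | _ n ih =>
    cases n with
    | zero => rw [add_zero, shifted_self, shifted_self]
    | succ n =>
      have h0 := shifted_add_succ f j 0 n
      rw [zero_add] at h0
      rw [shifted_add_succ, h0]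
      refine Finset.sum_congr rfl fun p hp => ?_
      have := Finset.HasAntidiagonal.mem_antidiagonal.1 hp
      rw [ih p.2 (by omega), ih p.2 (by omega)]

theorem shifted_succ (f : ℕ → ℂ) (j n : ℕ) :
    shifted f j 0 (n + 1) = ∑ p ∈ Finset.HasAntidiagonal.antidiagonal n,
      total f (Finset.range p.1) * shifted f (j + 1) 0 p.2 := by
  have h := shifted_add_succ f j 0 n
  rw [zero_add] at h
  simp only [h, shifted_add]

theorem mk_shifted (f : ℕ → ℂ) (j : ℕ) :
    PowerSeries.mk (shifted f j 0) = PowerSeries.C (f j) +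
      PowerSeries.X * (PowerSeries.mk (fun n => total f (Finset.range n)) *
        PowerSeries.mk (shifted f (j + 1) 0)) := by
  ext n
  cases n with
  | zero => simp [shifted_self]
  | succ n =>
    rw [map_add, PowerSeries.coeff_succ_X_mul, PowerSeries.coeff_mul]
    simp [shifted_succ]

/-- The weight `F_{k-1}`, with the convention `F_{-1} = 1`. -/
noncomputable def fibWeight : ℕ → ℂ
  | 0 => 1
  | k + 1 => Nat.fib k

theorem fibWeight_add_two (k : ℕ) : fibWeight (k + 2) = fibWeight (k + 1) + fibWeight k := by
  cases k with
  | zero => simp [fibWeight]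
  | succ k => simp [fibWeight, Nat.fib_add_two, add_comm]

theorem shifted_fibWeight_two (a b : ℕ) :
    shifted fibWeight 2 a b = shifted fibWeight 1 a b + shifted fibWeight 0 a b := by
  simp only [shifted, ← Finset.sum_add_distrib, ← add_mul, ← fibWeight_add_two, add_zero]

theorem isNC_parts_iff {n : ℕ} (π : Finpartition (Finset.univ : Finset (Fin n))) :
    IsNC Finset.univ π.parts ↔ IsNoncrossing π := by
  constructor
  · exact fun h a b c d hab hbc hcd B hB C hC ha hc hb hd =>
      h.eq_of_cross B hB C hC a b c d hab.le hbc.le hcd.le ha hb hc hd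
  · refine fun h => ⟨fun B _ => Finset.subset_univ B, π.bot_notMem, fun x hx => π.exists_mem hx,
      fun B hB C hC w x y z hwx hxy hyz hw hx hy hz => ?_⟩
    rcases hwx.eq_or_lt with rfl | hwx
    · exact π.eq_of_mem_parts hB hC hw hx
    rcases hxy.eq_or_lt with rfl | hxy
    · exact π.eq_of_mem_parts hB hC hy hx
    rcases hyz.eq_or_lt with rfl | hyz
    · exact π.eq_of_mem_parts hB hC hy hz
    exact h w x y z hwx hxy hyz B hB C hC hw hy hx hz

theorem IsNC.exists_finpartition {n : ℕ} {P : Finset (Finset (Fin n))}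
    (h : IsNC Finset.univ P) :
    ∃ π : Finpartition (Finset.univ : Finset (Fin n)), π.parts = P := by
  refine ⟨Finpartition.ofExistsUnique P h.subset (fun x hx => ?_) h.empty_notMem, rfl⟩
  obtain ⟨B, hB, hxB⟩ := h.exists_mem x hx
  exact ⟨B, ⟨hB, hxB⟩, fun C hC => h.eq_of_mem hC.1 hB hC.2 hxB⟩

theorem fibNCCount_eq_total (n : ℕ) : fibNCCount n = total fibWeight (Finset.range n) := by
  have hmap : (Finset.univ : Finset (Fin n)).map (Fin.valOrderEmb n).toEmbedding =
      Finset.range n := by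
    ext x
    simp only [Finset.mem_map, Finset.mem_univ, true_and, Finset.mem_range]
    exact ⟨by rintro ⟨y, rfl⟩; exact y.2, fun hx => ⟨⟨x, hx⟩, rfl⟩⟩
  rw [← hmap, total_map, fibNCCount, total]
  refine Finset.sum_bij (fun π _ => π.parts) (fun π hπ => ?_) (fun π _ π' _ h => ?_)
    (fun P hP => ?_) (fun π _ => Finset.prod_congr rfl fun B hB => ?_)
  · exact mem_nc.2 ((isNC_parts_iff π).2 (Finset.mem_filter.1 hπ).2)
  · exact Finpartition.ext h
  · rw [mem_nc] at hP
    obtain ⟨π, rfl⟩ := hP.exists_finpartition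
    exact ⟨π, Finset.mem_filter.2 ⟨Finset.mem_univ _, (isNC_parts_iff π).1 hP⟩, rfl⟩
  · obtain ⟨k, hk⟩ := Nat.exists_eq_succ_of_ne_zero
      (Finset.card_pos.2 (π.nonempty_of_mem_parts hB)).ne'
    simp [hk, fibWeight]

theorem shifted_fibWeight_zero (n : ℕ) : shifted fibWeight 0 0 n = fibNCCount n := by
  rw [shifted_zero rfl, fibNCCount_eq_total, Finset.range_eq_Ico]

theorem fibNCCount_zero : fibNCCount 0 = 1 := by
  rw [← shifted_fibWeight_zero, shifted_self, fibWeight]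

theorem fibNCCount_succ (n : ℕ) : fibNCCount (n + 1) =
    ∑ p ∈ Finset.HasAntidiagonal.antidiagonal n, fibNCCount p.1 * shifted fibWeight 1 0 p.2 := by
  rw [← shifted_fibWeight_zero, shifted_succ]
  simp only [fibNCCount_eq_total, zero_add]

theorem shifted_fibWeight_one_succ (n : ℕ) : shifted fibWeight 1 0 (n + 1) =
    ∑ p ∈ Finset.HasAntidiagonal.antidiagonal n,
      fibNCCount p.1 * (shifted fibWeight 1 0 p.2 + fibNCCount p.2) := by
  rw [shifted_succ]
  simp only [fibNCCount_eq_total, shifted_fibWeight_two, shifted_zero (f := fibWeight) rfl,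
    Finset.range_eq_Ico, Nat.reduceAdd]

theorem shifted_fibWeight_one_zero : shifted fibWeight 1 0 0 = 0 := by
  simp [shifted_self, fibWeight]

end NCPartition

/-- The generating function `G(x) = Σ b_n xⁿ` of the Fibonacci-weighted
noncrossing partition count satisfies `G = (1 - xG)/(1 - xG - x²G²)`, i.e.
`G·(1 - xG - x²G²) = 1 - xG`; and `(b_n)` begins `1, 0, 1, 1, 4, 8, 25, 64`. -/
theorem stmt_14 :
    (letI G : PowerSeries ℂ := PowerSeries.mk fibNCCount
     G * (1 - PowerSeries.X * G - PowerSeries.X ^ 2 * G ^ 2) =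
       1 - PowerSeries.X * G) ∧
    fibNCCount 0 = 1 ∧ fibNCCount 1 = 0 ∧ fibNCCount 2 = 1 ∧ fibNCCount 3 = 1 ∧
    fibNCCount 4 = 4 ∧ fibNCCount 5 = 8 ∧ fibNCCount 6 = 25 ∧ fibNCCount 7 = 64 := by
  refine ⟨?_, ?_⟩
  · have h0 := NCPartition.mk_shifted NCPartition.fibWeight 0
    have h1 := NCPartition.mk_shifted NCPartition.fibWeight 1
    have h2 : PowerSeries.mk (NCPartition.shifted NCPartition.fibWeight 2 0) =
        PowerSeries.mk (NCPartition.shifted NCPartition.fibWeight 1 0) +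
          PowerSeries.mk fibNCCount := by
      ext n
      simp [NCPartition.shifted_fibWeight_two, NCPartition.shifted_fibWeight_zero]
    simp only [← NCPartition.fibNCCount_eq_total, NCPartition.fibWeight,
      map_one, Nat.fib_zero, Nat.cast_zero, map_zero, zero_add,
      Nat.reduceAdd, h2, funext NCPartition.shifted_fibWeight_zero] at h0 h1
    linear_combination (1 - PowerSeries.X * PowerSeries.mk fibNCCount) * h0 +
      PowerSeries.X * PowerSeries.mk fibNCCount * h1
  · have h0 := NCPartition.fibNCCount_zero
    have v0 := NCPartition.shifted_fibWeight_one_zero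
    have hs := NCPartition.fibNCCount_succ
    have vs := NCPartition.shifted_fibWeight_one_succ
    simp only [Finset.Nat.sum_antidiagonal_eq_sum_range_succ_mk] at hs vs
    have h1 : fibNCCount 1 = 0 := by simp [hs, v0]
    have v1 : NCPartition.shifted NCPartition.fibWeight 1 0 1 = 1 := by simp [vs, h0, v0]
    have h2 : fibNCCount 2 = 1 := by
      rw [hs]; norm_num [Finset.sum_range_succ, h0, h1, v0, v1]
    have v2 : NCPartition.shifted NCPartition.fibWeight 1 0 2 = 1 := by
      rw [vs]; norm_num [Finset.sum_range_succ, h0, h1, v0, v1]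
    have h3 : fibNCCount 3 = 1 := by
      rw [hs]; norm_num [Finset.sum_range_succ, h0, h1, h2, v0, v1, v2]
    have v3 : NCPartition.shifted NCPartition.fibWeight 1 0 3 = 3 := by
      rw [vs]; norm_num [Finset.sum_range_succ, h0, h1, h2, v0, v1, v2]
    have h4 : fibNCCount 4 = 4 := by
      rw [hs]; norm_num [Finset.sum_range_succ, h0, h1, h2, h3, v0, v1, v2, v3]
    have v4 : NCPartition.shifted NCPartition.fibWeight 1 0 4 = 6 := by
      rw [vs]; norm_num [Finset.sum_range_succ, h0, h1, h2, h3, v0, v1, v2, v3]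
    have h5 : fibNCCount 5 = 8 := by
      rw [hs]; norm_num [Finset.sum_range_succ, h0, h1, h2, h3, h4, v0, v1, v2, v3, v4]
    have v5 : NCPartition.shifted NCPartition.fibWeight 1 0 5 = 17 := by
      rw [vs]; norm_num [Finset.sum_range_succ, h0, h1, h2, h3, h4, v0, v1, v2, v3, v4]
    have h6 : fibNCCount 6 = 25 := by
      rw [hs]; norm_num [Finset.sum_range_succ, h0, h1, h2, h3, h4, h5, v0, v1, v2, v3, v4, v5]
    have v6 : NCPartition.shifted NCPartition.fibWeight 1 0 6 = 43 := by
      rw [vs]; norm_num [Finset.sum_range_succ, h0, h1, h2, h3, h4, h5, v0, v1, v2, v3, v4, v5]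
    have h7 : fibNCCount 7 = 64 := by
      rw [hs]
      norm_num [Finset.sum_range_succ, h0, h1, h2, h3, h4, h5, h6, v0, v1, v2, v3, v4, v5, v6]
    exact ⟨h0, h1, h2, h3, h4, h5, h6, h7⟩
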